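/- (Corollary 1: one block of missing observations.) Assume the setup below with S = {−(M+N), …, −M} a single block, and suppose c solves the normal system: Σ_{j∈Z^S} a(j)^⊤ R(k,j) = Σ_{j∈U} c(j)^⊤ B(k,j) for all k ∈ U. Then: (i) (1/2π)∫_{−π}^{π} h(λ)^⊤ e^{−ikλ} dλ = 0 for every k ∈ U; (ii) for every finitely supported b : ℤ → ℂ^T with support contained in Z₋∖S, setting g(λ) = Σ_{n∈Z₋∖S} b(n) e^{inλ}, one has Δ(h;F,G) ≤ Δ(g;F,G); and (iii) Δ(h;F,G) = Σ_{k∈U} ( Σ_{j∈Z^S} a(j)^⊤ R(k,j) ) conj(c(k)) + Σ_{j,k∈Z^S} a(j)^⊤ Q(j,k) conj(a(k)). -/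

import Mathlib

open MeasureTheory
open scoped ComplexOrder

namespace Filt
open Matrix

noncomputable def ee (z : ℤ) (x : ℝ) : ℂ := Complex.exp (Complex.I * (z : ℂ) * (x : ℂ))

lemma ee_norm (z : ℤ) (x : ℝ) : ‖ee z x‖ = 1 := by
  unfold ee
  rw [show Complex.I * (z : ℂ) * (x : ℂ) = ((z * x : ℝ) : ℂ) * Complex.I by push_cast; ring]
  exact Complex.norm_exp_ofReal_mul_I _

lemma ee_cont (z : ℤ) : Continuous (ee z) := by
  unfold ee; fun_prop

lemma ee_add (z w : ℤ) (x : ℝ) : ee (z + w) x = ee z x * ee w x := by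
  unfold ee; rw [← Complex.exp_add]; congr 1; push_cast; ring

lemma ee_conj (z : ℤ) (x : ℝ) : (starRingEnd ℂ) (ee z x) = ee (-z) x := by
  unfold ee; rw [← Complex.exp_conj]; congr 1; simp

noncomputable def mu : Measure ℝ := volume.restrict (Set.Ioc (-Real.pi) Real.pi)

instance : IsFiniteMeasure mu := by unfold mu; infer_instance

lemma int_mu (f : ℝ → ℂ) : ∫ x in (-Real.pi)..Real.pi, f x = ∫ x, f x ∂mu := by
  rw [intervalIntegral.integral_of_le (by linarith [Real.pi_pos])]; rfl

lemma ii_mu (f : ℝ → ℂ) : IntervalIntegrable f volume (-Real.pi) Real.pi ↔ Integrable f mu := by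
  rw [intervalIntegrable_iff_integrableOn_Ioc_of_le (by linarith [Real.pi_pos])]; rfl

lemma ee_orth (z : ℤ) (hz : z ≠ 0) : ∫ x, ee z x ∂mu = 0 := by
  rw [← int_mu]
  unfold ee
  have hc : Complex.I * (z : ℂ) ≠ 0 := by simp [hz]
  rw [integral_exp_mul_complex hc]
  have : Complex.exp (Complex.I * z * (Real.pi : ℝ)) = Complex.exp (Complex.I * z * ((-Real.pi : ℝ) : ℂ)) := by
    rw [Complex.exp_eq_exp_iff_exists_int]
    exact ⟨z, by push_cast; ring⟩
  rw [this]; simp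

/-- bounded a.e.-measurable -/
def BC (f : ℝ → ℂ) : Prop := AEStronglyMeasurable f mu ∧ ∃ K : ℝ, ∀ x, ‖f x‖ ≤ K

lemma BC.mul {f g : ℝ → ℂ} (hf : BC f) (hg : Integrable g mu) :
    Integrable (fun x => f x * g x) mu := by
  obtain ⟨h1, K, hK⟩ := hf
  exact hg.bdd_mul h1 (Filter.Eventually.of_forall hK)

lemma BC.sub {f g : ℝ → ℂ} (hf : BC f) (hg : BC g) : BC (fun x => f x - g x) := by
  obtain ⟨h1, K, hK⟩ := hf
  obtain ⟨h2, L, hL⟩ := hg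
  exact ⟨h1.sub h2, K + L, fun x => (norm_sub_le _ _).trans (add_le_add (hK x) (hL x))⟩

lemma BC.conj {f : ℝ → ℂ} (hf : BC f) : BC (fun x => (starRingEnd ℂ) (f x)) := by
  obtain ⟨h1, K, hK⟩ := hf
  exact ⟨Complex.continuous_conj.comp_aestronglyMeasurable h1, K, by simpa using hK⟩

lemma BC.int {f : ℝ → ℂ} (hf : BC f) : Integrable f mu := by
  simpa using hf.mul (integrable_const (1 : ℂ))

lemma int_conj {f : ℝ → ℂ} (hf : Integrable f mu) :
    Integrable (fun x => (starRingEnd ℂ) (f x)) mu :=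
  (LinearIsometryEquiv.integrable_comp_iff Complex.conjLIE).2 hf

lemma BC_ee (z : ℤ) : BC (ee z) :=
  ⟨(ee_cont z).aestronglyMeasurable, 1, fun x => (ee_norm z x).le⟩

lemma BC_series {ι : Type} {e : ι → ℝ → ℂ} (hec : ∀ j, Continuous (e j))
    (hen : ∀ j x, ‖e j x‖ = 1) {u : ι → ℂ} (hu : Summable fun j => ‖u j‖) : BC (fun x => ∑' j, u j * e j x) := by
  constructor
  · apply Continuous.aestronglyMeasurable
    refine continuous_tsum (fun j => continuous_const.mul (hec j)) hu ?_
    intro j x; simp [hen]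
  · refine ⟨∑' j, ‖u j‖, fun x => ?_⟩
    refine tsum_of_norm_bounded hu.hasSum ?_
    intro j; simp [hen]

lemma series_int {ι : Type} [Countable ι] {e : ι → ℝ → ℂ} (hec : ∀ j, Continuous (e j))
    (hen : ∀ j x, ‖e j x‖ = 1) {u : ι → ℂ} (hu : Summable fun j => ‖u j‖)
    {f : ℝ → ℂ} (hf : Integrable f mu) :
    HasSum (fun j => u j * ∫ x, e j x * f x ∂mu) (∫ x, (∑' j, u j * e j x) * f x ∂mu) := by
  have hi : ∀ j, Integrable (fun x => u j * (e j x * f x)) mu := by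
    intro j
    refine Integrable.const_mul ?_ _
    exact hf.bdd_mul (hec j).aestronglyMeasurable
      (Filter.Eventually.of_forall fun x => (hen j x).le)
  have := hasSum_integral_of_summable_integral_norm hi (by
    simp only [norm_mul, hen, one_mul, integral_const_mul]
    exact hu.mul_right _)
  simp only [integral_const_mul] at this
  simpa only [← tsum_mul_right, mul_assoc] using this

/-- matrix Cauchy-Schwarz, weak form -/
lemma cs {n : ℕ} {N : Matrix (Fin n) (Fin n) ℂ} (hN : N.PosSemidef) (u v : Fin n → ℂ) :
    ‖star u ⬝ᵥ N *ᵥ v‖ ≤ (star u ⬝ᵥ N *ᵥ u).re + (star v ⬝ᵥ N *ᵥ v).re := by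
  have hu := (Complex.le_def.1 (hN.dotProduct_mulVec_nonneg u)).1
  have hv := (Complex.le_def.1 (hN.dotProduct_mulVec_nonneg v)).1
  have h1 : ∀ w : ℂ, ‖w‖ = 1 → 2 * (w * (star u ⬝ᵥ N *ᵥ v)).re ≤
      (star u ⬝ᵥ N *ᵥ u).re + (star v ⬝ᵥ N *ᵥ v).re := by
    intro w hw
    have h0 := (Complex.le_def.1 (hN.dotProduct_mulVec_nonneg (u - w • v))).1
    have hs : star v ⬝ᵥ N *ᵥ u = star (star u ⬝ᵥ N *ᵥ v) := by
      rw [Matrix.star_dotProduct, star_mulVec, hN.1.eq, ← dotProduct_mulVec]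
    have hww : w * star w = 1 := by
      have := Complex.mul_conj' w
      rw [hw] at this; simpa using this
    simp only [star_sub, star_smul, mulVec_sub, mulVec_smul, sub_dotProduct, dotProduct_sub,
      smul_dotProduct, dotProduct_smul, smul_eq_mul, hs, mul_sub] at h0
    rw [← mul_assoc w (star w), hww] at h0
    rw [← star_mul'] at h0
    simp at h0 ⊢
    linarith
  simp only [Complex.zero_re] at hu hv
  generalize star u ⬝ᵥ N *ᵥ v = z at *
  by_cases hz : z = 0
  · simp only [hz, norm_zero]; linarith
  · have hz' : ‖z‖ ≠ 0 := by simpa using hz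
    have h2 := h1 ((starRingEnd ℂ) z / ‖z‖) (by simp [hz'])
    have : (starRingEnd ℂ) z / ‖z‖ * z = (‖z‖ : ℂ) := by
      rw [div_mul_eq_mul_div, Complex.conj_mul']
      have : (‖z‖ : ℂ) ≠ 0 := by exact_mod_cast hz'
      field_simp
    rw [this, Complex.ofReal_re] at h2
    have := norm_nonneg z
    linarith

lemma cs_entry {n : ℕ} {N : Matrix (Fin n) (Fin n) ℂ} (hN : N.PosSemidef)
    (X Y : Matrix (Fin n) (Fin n) ℂ) (p q : Fin n) :
    ‖(Xᴴ * N * Y) p q‖ ≤ ((Xᴴ * N * X) p p).re + ((Yᴴ * N * Y) q q).re := by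
  have key : ∀ (X Y : Matrix (Fin n) (Fin n) ℂ) (p q : Fin n),
      (Xᴴ * N * Y) p q = star (fun i => X i p) ⬝ᵥ N *ᵥ (fun i => Y i q) := by
    intro X Y p q
    rw [Matrix.mul_assoc]
    simp [Matrix.mul_apply, dotProduct, mulVec]
  rw [key, key, key]
  exact cs hN _ _

section pt
variable {n : ℕ} {F G P : Matrix (Fin n) (Fin n) ℂ}

lemma psd_diff (hF : F.PosSemidef) (hG : G.PosSemidef) (hP : P.PosSemidef)
    (h1 : (F + G) * P = 1) : (F - F * P * F).PosSemidef := by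
  have e : F - F * P * F = (1 - P * F)ᴴ * F * (1 - P * F) + (P * F)ᴴ * G * (P * F) := by
    simp only [conjTranspose_sub, conjTranspose_mul, conjTranspose_one, hF.1.eq, hP.1.eq]
    have : F * P * F * (P * F) + F * P * G * (P * F) = F * P * F := by
      rw [← Matrix.add_mul, ← Matrix.mul_add, Matrix.mul_assoc (F * P), ← Matrix.mul_assoc (F + G), h1,
        Matrix.one_mul, Matrix.mul_assoc]
    calc F - F * P * F = F - F * P * F - F * P * F + F * P * F := by abel
      _ = F - F * P * F - F * P * F + (F * P * F * (P * F) + F * P * G * (P * F)) := by rw [this]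
      _ = _ := by noncomm_ring
  rw [e]
  exact (hF.conjTranspose_mul_mul_same _).add (hG.conjTranspose_mul_mul_same _)

lemma bd_FP (hF : F.PosSemidef) (hG : G.PosSemidef) (hP : P.PosSemidef)
    (h1 : (F + G) * P = 1) (p q : Fin n) :
    ‖(F * P) p q‖ ≤ (F p p).re + (P q q).re := by
  have := cs_entry hF 1 P p q
  simp only [conjTranspose_one, Matrix.one_mul, Matrix.mul_one] at this
  refine this.trans ?_
  have e : P = Pᴴ * F * P + Pᴴ * G * P := by
    rw [← Matrix.add_mul, ← Matrix.mul_add, Matrix.mul_assoc, h1, Matrix.mul_one, hP.1.eq]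
  have h2 := congrFun (congrFun e q) q
  have h3 := congrArg Complex.re h2
  have h4 := (Complex.le_def.1 ((hG.conjTranspose_mul_mul_same P).diag_nonneg (i := q))).1
  simp only [Matrix.add_apply, Complex.add_re, Complex.zero_re] at h3 h4
  linarith

lemma bd_FPF (hF : F.PosSemidef) (hG : G.PosSemidef) (hP : P.PosSemidef)
    (h1 : (F + G) * P = 1) (p q : Fin n) :
    ‖(F * P * F) p q‖ ≤ (F p p).re + (F q q).re := by
  have := cs_entry hP F F p q
  rw [hF.1.eq] at this
  refine this.trans ?_
  have h4 := fun p => (Complex.le_def.1 ((psd_diff hF hG hP h1).diag_nonneg (i := p))).1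
  simp only [Matrix.sub_apply, Complex.sub_re, Complex.zero_re] at h4
  linarith [h4 p, h4 q]

lemma pt_id (hF : Fᴴ = F) (hP : Pᴴ = P) (h1 : (F + G) * P = 1)
    (h2 : P * (F + G) = 1) (A C h g : Fin n → ℂ)
    (hh : h = A ᵥ* (F * P) - C ᵥ* P) :
    (A - g) ⬝ᵥ F *ᵥ star (A - g) + g ⬝ᵥ G *ᵥ star g =
      A ⬝ᵥ (F * P * G) *ᵥ star A + C ⬝ᵥ P *ᵥ star C
       - (g - h) ⬝ᵥ star C - C ⬝ᵥ star (g - h) + (g - h) ⬝ᵥ (F + G) *ᵥ star (g - h) := by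
  obtain ⟨d, rfl⟩ : ∃ d, g = h + d := ⟨g - h, by abel⟩
  have c1 : h ᵥ* (F + G) = A ᵥ* F - C := by
    rw [hh, sub_vecMul, vecMul_vecMul, vecMul_vecMul, Matrix.mul_assoc, h2, Matrix.mul_one,
      vecMul_one]
  have sh : star h = (P * F) *ᵥ star A - P *ᵥ star C := by
    rw [hh, star_sub, star_vecMul, star_vecMul, conjTranspose_mul, hF, hP]
  have c2 : (F + G) *ᵥ star h = F *ᵥ star A - star C := by
    rw [sh, mulVec_sub, mulVec_mulVec, mulVec_mulVec, ← Matrix.mul_assoc, h1, Matrix.one_mul,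
      one_mulVec]
  have hFPG : F * P * G = F - F * P * F := by
    rw [eq_sub_iff_add_eq, ← Matrix.mul_add, Matrix.mul_assoc, add_comm G F, h2, Matrix.mul_one]
  have e1 : (h + d) ⬝ᵥ (F + G) *ᵥ star (h + d) =
      A ⬝ᵥ F *ᵥ star (h + d) - C ⬝ᵥ star (h + d) + (d ⬝ᵥ F *ᵥ star A - d ⬝ᵥ star C)
        + d ⬝ᵥ (F + G) *ᵥ star d := by
    rw [add_dotProduct, dotProduct_mulVec, c1, sub_dotProduct, ← dotProduct_mulVec,
      star_add h d, mulVec_add (F + G), c2, dotProduct_add d, dotProduct_sub d]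
    ring
  have e2 : h ⬝ᵥ F *ᵥ star A = A ⬝ᵥ (F * P * F) *ᵥ star A - C ⬝ᵥ (P * F) *ᵥ star A := by
    rw [hh, sub_dotProduct, dotProduct_mulVec, vecMul_vecMul, ← dotProduct_mulVec,
      dotProduct_mulVec (C ᵥ* P), vecMul_vecMul, ← dotProduct_mulVec]
  have e3 : C ⬝ᵥ star h = C ⬝ᵥ (P * F) *ᵥ star A - C ⬝ᵥ P *ᵥ star C := by
    rw [sh, dotProduct_sub]
  have e0 : (A - (h + d)) ⬝ᵥ F *ᵥ star (A - (h + d)) + (h + d) ⬝ᵥ G *ᵥ star (h + d) =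
      A ⬝ᵥ F *ᵥ star A - A ⬝ᵥ F *ᵥ star (h + d) - (h + d) ⬝ᵥ F *ᵥ star A
        + (h + d) ⬝ᵥ (F + G) *ᵥ star (h + d) := by
    generalize h + d = g
    simp only [star_sub, mulVec_sub, sub_dotProduct, dotProduct_sub, add_mulVec, dotProduct_add]
    ring
  rw [e0, e1, add_sub_cancel_left, hFPG, sub_mulVec, dotProduct_sub, add_dotProduct h d, e2,
    star_add, dotProduct_add, e3]
  ring
end pt

lemma form_eq {n : ℕ} (u v : Fin n → ℂ) (N : Matrix (Fin n) (Fin n) ℂ) :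
    ∑ p, ∑ q, u p * N p q * (starRingEnd ℂ) (v q) = u ⬝ᵥ N *ᵥ star v := by
  simp [dotProduct, mulVec, Finset.mul_sum, mul_assoc]

lemma int_form {n : ℕ} {u v : ℝ → Fin n → ℂ} {N : ℝ → Matrix (Fin n) (Fin n) ℂ}
    (hu : ∀ p, BC (fun x => u x p)) (hv : ∀ p, BC (fun x => v x p))
    (hN : ∀ p q, Integrable (fun x => N x p q) mu) :
    Integrable (fun x => u x ⬝ᵥ N x *ᵥ star (v x)) mu := by
  simp only [← form_eq]
  refine integrable_finsetSum _ fun p _ => integrable_finsetSum _ fun q _ => ?_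
  have := (hu p).mul ((hv q).conj.mul (hN p q))
  refine this.congr (Filter.Eventually.of_forall fun x => ?_)
  ring

lemma BC_vec {n : ℕ} {u : ℤ → Fin n → ℂ} (hu : Summable fun j : ℤ => ∑ k, ‖u j k‖) (p : Fin n) :
    Summable fun j => ‖u j p‖ :=
  Summable.of_nonneg_of_le (fun _ => norm_nonneg _)
    (fun j => Finset.single_le_sum (f := fun k => ‖u j k‖) (fun _ _ => norm_nonneg _)
      (Finset.mem_univ p)) hu

lemma vec_sum {n : ℕ} {u : ℤ → Fin n → ℂ} (hu : Summable fun j : ℤ => ∑ k, ‖u j k‖)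
    {e : ℤ → ℝ → ℂ} (hec : ∀ j, Continuous (e j)) (hen : ∀ j x, ‖e j x‖ = 1)
    {V : ℝ → Fin n → ℂ} (hV : ∀ x p, V x p = ∑' j, u j p * e j x)
    {N : ℝ → Matrix (Fin n) (Fin n) ℂ} (hN : ∀ p q, Integrable (fun x => N x p q) mu)
    (r : ℂ) (k : ℤ) (W : ℤ → Matrix (Fin n) (Fin n) ℂ)
    (hW : ∀ j p q, W j p q = r * ∫ x, e j x * (N x p q * ee (-k) x) ∂mu) :
    HasSum (fun j => vecMul (u j) (W j))
      (fun q => r * ∫ x, vecMul (V x) (N x) q * ee (-k) x ∂mu) := by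
  rw [Pi.hasSum]
  intro q
  have hNk : ∀ p, Integrable (fun x => N x p q * ee (-k) x) mu := by
    intro p
    simpa only [mul_comm] using (BC_ee (-k)).mul (hN p q)
  have hBC : ∀ p, BC (fun x => V x p) := by
    intro p; simp only [hV]; exact BC_series hec hen (BC_vec hu p)
  have h1 : ∀ p, HasSum (fun j => u j p * ∫ x, e j x * (N x p q * ee (-k) x) ∂mu)
      (∫ x, V x p * (N x p q * ee (-k) x) ∂mu) := by
    intro p
    simp only [hV]
    exact series_int hec hen (BC_vec hu p) (hNk p)
  have h2 := (hasSum_sum (s := Finset.univ) fun p _ => h1 p).mul_left r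
  rw [← integral_finsetSum _ (fun p _ => (hBC p).mul (hNk p))] at h2
  have g1 : (fun j => vecMul (u j) (W j) q) = fun j => r * ∑ p, u j p *
      ∫ x, e j x * (N x p q * ee (-k) x) ∂mu := by
    funext j
    simp only [vecMul, dotProduct, hW, Finset.mul_sum]
    refine Finset.sum_congr rfl fun p _ => ?_
    ring
  have g2 : ∀ x, vecMul (V x) (N x) q * ee (-k) x = ∑ p, V x p * (N x p q * ee (-k) x) := by
    intro x
    simp only [vecMul, dotProduct, Finset.sum_mul, mul_assoc]
  simp only [g2]
  rw [g1]
  exact h2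

lemma int_mul_conj_zero {u : ℤ → ℂ} (hu : Summable fun j => ‖u j‖) {w : ℝ → ℂ}
    (hw : Integrable w mu) (h0 : ∀ j, u j = 0 ∨ ∫ x, w x * ee (-j) x ∂mu = 0) :
    ∫ x, (∑' j, u j * ee j x) * (starRingEnd ℂ) (w x) ∂mu = 0 := by
  have h1 := series_int ee_cont ee_norm hu (int_conj hw)
  refine h1.unique ?_
  convert hasSum_zero using 2 with j
  rcases h0 j with h | h
  · simp [h]
  · have : ∫ x, ee j x * (starRingEnd ℂ) (w x) ∂mu
        = (starRingEnd ℂ) (∫ x, w x * ee (-j) x ∂mu) := by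
      rw [← integral_conj]
      congr 1; funext x
      rw [map_mul, ee_conj, neg_neg, mul_comm]
    rw [this, h]; simp

end Filt


set_option maxHeartbeats 1000000 in
open Filt Matrix in
/-- Corollary 1: one block of missing observations,
`S = {−(M+N),…,−M}`: if `c` solves the normal system then the Fourier coefficients
of `h` vanish on `U`, `h` is the optimal filter, and the mean-square error is given
by formula (55). -/
theorem stmt_10
    (T Mn Nn : ℕ) (hT : 1 ≤ T) (hM : 1 ≤ Mn)
    (S U ZS Zneg : Set ℤ)
    (hS : S = Set.Icc (-((Mn : ℤ) + (Nn : ℤ))) (-(Mn : ℤ)))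
    (hU : U = S ∪ {j : ℤ | 0 ≤ j})
    (hZS : ZS = {j : ℤ | 1 ≤ j} \ {j : ℤ | -j ∈ S})
    (hZneg : Zneg = {j : ℤ | j < 0})
    (F G : ℝ → Matrix (Fin T) (Fin T) ℂ)
    (hFmeas : ∀ p q, Measurable fun x => F x p q)
    (hGmeas : ∀ p q, Measurable fun x => G x p q)
    (hFpsd : ∀ᵐ x : ℝ, x ∈ Set.Icc (-Real.pi) Real.pi → (F x).PosSemidef)
    (hGpsd : ∀ᵐ x : ℝ, x ∈ Set.Icc (-Real.pi) Real.pi → (G x).PosSemidef)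
    (hFint : ∀ p q, IntervalIntegrable (fun x => F x p q) volume (-Real.pi) Real.pi)
    (hGint : ∀ p q, IntervalIntegrable (fun x => G x p q) volume (-Real.pi) Real.pi)
    (hinv : ∀ᵐ x : ℝ, x ∈ Set.Icc (-Real.pi) Real.pi → IsUnit (F x + G x))
    (hmin : ∀ p q, IntervalIntegrable (fun x => (F x + G x)⁻¹ p q) volume (-Real.pi) Real.pi)
    (a : ℤ → Fin T → ℂ) (ha0 : ∀ j, j ∉ ZS → a j = 0)
    (haSum : Summable fun j : ℤ => ∑ k, ‖a j k‖)
    (A : ℝ → Fin T → ℂ)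
    (hA : ∀ x k, A x k = ∑' j : ℤ, a j k * Complex.exp (-(Complex.I * (j : ℂ) * (x : ℂ))))
    (c : ℤ → Fin T → ℂ) (hc0 : ∀ j, j ∉ U → c j = 0)
    (hcSum : Summable fun j : ℤ => ∑ k, ‖c j k‖)
    (Cf : ℝ → Fin T → ℂ)
    (hCf : ∀ x k, Cf x k = ∑' j : ℤ, c j k * Complex.exp (Complex.I * (j : ℂ) * (x : ℂ)))
    (h : ℝ → Fin T → ℂ)
    (hh : ∀ x, h x = Matrix.vecMul (A x) (F x * (F x + G x)⁻¹) -
      Matrix.vecMul (Cf x) (F x + G x)⁻¹)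
    (B R Q : ℤ → ℤ → Matrix (Fin T) (Fin T) ℂ)
    (hB : ∀ k j p q, B k j p q = (1 / (2 * (Real.pi : ℂ))) *
      ∫ x in (-Real.pi)..Real.pi,
        (F x + G x)⁻¹ p q * Complex.exp (-(Complex.I * ((k : ℂ) - (j : ℂ)) * (x : ℂ))))
    (hR : ∀ k j p q, R k j p q = (1 / (2 * (Real.pi : ℂ))) *
      ∫ x in (-Real.pi)..Real.pi,
        (F x * (F x + G x)⁻¹) p q * Complex.exp (-(Complex.I * ((k : ℂ) + (j : ℂ)) * (x : ℂ))))
    (hQ : ∀ k j p q, Q k j p q = (1 / (2 * (Real.pi : ℂ))) *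
      ∫ x in (-Real.pi)..Real.pi,
        (F x * (F x + G x)⁻¹ * G x) p q *
          Complex.exp (-(Complex.I * ((k : ℂ) - (j : ℂ)) * (x : ℂ))))
    (Δ : (ℝ → Fin T → ℂ) → ℂ)
    (hΔ : ∀ g : ℝ → Fin T → ℂ, Δ g =
      (1 / (2 * (Real.pi : ℂ))) * (∫ x in (-Real.pi)..Real.pi,
        ∑ p, ∑ q, (A x p - g x p) * F x p q * (starRingEnd ℂ) (A x q - g x q)) +
      (1 / (2 * (Real.pi : ℂ))) * (∫ x in (-Real.pi)..Real.pi,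
        ∑ p, ∑ q, g x p * G x p q * (starRingEnd ℂ) (g x q)))
    (hnormal : ∀ k ∈ U,
      (∑' j : ℤ, Matrix.vecMul (a j) (R k j)) = ∑' j : ℤ, Matrix.vecMul (c j) (B k j)) :
    (∀ k ∈ U, ∀ q, (1 / (2 * (Real.pi : ℂ))) *
        (∫ x in (-Real.pi)..Real.pi,
          h x q * Complex.exp (-(Complex.I * (k : ℂ) * (x : ℂ)))) = 0) ∧
    (∀ b : ℤ → Fin T → ℂ, (Function.support b).Finite →
      (∀ n : ℤ, b n ≠ 0 → n ∈ Zneg \ S) →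
      (Δ h).re ≤
        (Δ (fun x k => ∑' n : ℤ, b n k * Complex.exp (Complex.I * (n : ℂ) * (x : ℂ)))).re) ∧
    Δ h = (∑' k : ℤ, ∑ q,
        (∑' j : ℤ, Matrix.vecMul (a j) (R k j)) q * (starRingEnd ℂ) (c k q)) +
      ∑' jk : ℤ × ℤ, ∑ p, ∑ q,
        a jk.1 p * Q jk.1 jk.2 p q * (starRingEnd ℂ) (a jk.2 q) := by
  set r : ℂ := 1 / (2 * (Real.pi : ℂ)) with hr
  have hrr : r = ((1 / (2 * Real.pi) : ℝ) : ℂ) := by rw [hr]; push_cast; rfl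
  have hrpos : 0 ≤ 1 / (2 * Real.pi) := by positivity
  have eP : ∀ (j : ℤ) (x : ℝ), Complex.exp (Complex.I * (j : ℂ) * (x : ℂ)) = ee j x :=
    fun _ _ => rfl
  have eN : ∀ (j : ℤ) (x : ℝ), Complex.exp (-(Complex.I * (j : ℂ) * (x : ℂ))) = ee (-j) x := by
    intro j x; unfold ee; congr 1; push_cast; ring
  have eD : ∀ (k j : ℤ) (x : ℝ),
      Complex.exp (-(Complex.I * ((k : ℂ) - (j : ℂ)) * (x : ℂ))) = ee (-k) x * ee j x := by
    intro k j x; rw [← ee_add]; unfold ee; congr 1; push_cast; ring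
  have eS : ∀ (k j : ℤ) (x : ℝ),
      Complex.exp (-(Complex.I * ((k : ℂ) + (j : ℂ)) * (x : ℂ))) = ee (-k) x * ee (-j) x := by
    intro k j x; rw [← ee_add]; unfold ee; congr 1; push_cast; ring
  simp only [int_mu, ii_mu, eP, eN, eD, eS] at *
  set P : ℝ → Matrix (Fin T) (Fin T) ℂ := fun x => (F x + G x)⁻¹ with hP
  have toMu : ∀ {p : ℝ → Prop}, (∀ᵐ x : ℝ, x ∈ Set.Icc (-Real.pi) Real.pi → p x) →
      ∀ᵐ x ∂mu, p x := by
    intro p hp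
    unfold mu
    rw [ae_restrict_iff' measurableSet_Ioc]
    filter_upwards [hp] with x hx hx2
    exact hx (Set.Ioc_subset_Icc_self hx2)
  have hall : ∀ᵐ x ∂mu, (F x).PosSemidef ∧ (G x).PosSemidef ∧ (P x).PosSemidef ∧
      (F x + G x) * P x = 1 ∧ P x * (F x + G x) = 1 := by
    filter_upwards [toMu hFpsd, toMu hGpsd, toMu hinv] with x h1 h2 h3
    have hd : IsUnit (F x + G x).det := (Matrix.isUnit_iff_isUnit_det _).1 h3
    exact ⟨h1, h2, (h1.add h2).inv, Matrix.mul_nonsing_inv _ hd, Matrix.nonsing_inv_mul _ hd⟩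
  have hPm : ∀ p q, AEStronglyMeasurable (fun x => P x p q) mu :=
    fun p q => (hmin p q).aestronglyMeasurable
  have hFm : ∀ p q, AEStronglyMeasurable (fun x => F x p q) mu :=
    fun p q => (hFint p q).aestronglyMeasurable
  have mulm : ∀ {X Y : ℝ → Matrix (Fin T) (Fin T) ℂ},
      (∀ p q, AEStronglyMeasurable (fun x => X x p q) mu) →
      (∀ p q, AEStronglyMeasurable (fun x => Y x p q) mu) →
      ∀ p q, AEStronglyMeasurable (fun x => (X x * Y x) p q) mu := by
    intro X Y hX hY p q
    simp only [Matrix.mul_apply]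
    exact Finset.aestronglyMeasurable_fun_sum _ fun i _ => (hX p i).mul (hY i q)
  have hFP : ∀ p q, Integrable (fun x => (F x * P x) p q) mu := by
    intro p q
    refine Integrable.mono' ((hFint p p).re.add (hmin q q).re) (mulm hFm hPm p q) ?_
    filter_upwards [hall] with x hx
    exact bd_FP hx.1 hx.2.1 hx.2.2.1 hx.2.2.2.1 p q
  have hFPF : ∀ p q, Integrable (fun x => (F x * P x * F x) p q) mu := by
    intro p q
    refine Integrable.mono' ((hFint p p).re.add (hFint q q).re)
      (mulm (mulm hFm hPm) hFm p q) ?_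
    filter_upwards [hall] with x hx
    exact bd_FPF hx.1 hx.2.1 hx.2.2.1 hx.2.2.2.1 p q
  have hFPG : ∀ p q, Integrable (fun x => (F x * P x * G x) p q) mu := by
    intro p q
    refine ((hFint p q).sub (hFPF p q)).congr ?_
    filter_upwards [hall] with x hx
    have : F x * P x * G x = F x - F x * P x * F x := by
      rw [eq_sub_iff_add_eq, ← Matrix.mul_add, Matrix.mul_assoc, add_comm (G x) (F x),
        hx.2.2.2.2, Matrix.mul_one]
    simp [this]
  have eeNc : ∀ j : ℤ, Continuous (fun x => ee (-j) x) := fun j => ee_cont (-j)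
  have eeNn : ∀ (j : ℤ) (x : ℝ), ‖ee (-j) x‖ = 1 := fun j x => ee_norm (-j) x
  have hABC : ∀ p, BC (fun x => A x p) := by
    intro p; simp only [hA]; exact BC_series eeNc eeNn (BC_vec haSum p)
  have hCBC : ∀ p, BC (fun x => Cf x p) := by
    intro p; simp only [hCf]; exact BC_series ee_cont ee_norm (BC_vec hcSum p)
  have hAR : ∀ k, HasSum (fun j => vecMul (a j) (R k j))
      (fun q => r * ∫ x, vecMul (A x) (F x * P x) q * ee (-k) x ∂mu) := by
    intro k
    refine vec_sum haSum eeNc eeNn hA hFP r k (fun j => R k j) ?_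
    intro j p q
    rw [hR]; congr 2; funext x; ring
  have hCB : ∀ k, HasSum (fun j => vecMul (c j) (B k j))
      (fun q => r * ∫ x, vecMul (Cf x) (P x) q * ee (-k) x ∂mu) := by
    intro k
    refine vec_sum hcSum ee_cont ee_norm hCf hmin r k (fun j => B k j) ?_
    intro j p q
    rw [hB]; congr 2; funext x; ring
  have hint1 : ∀ q, Integrable (fun x => vecMul (A x) (F x * P x) q) mu := by
    intro q
    simp only [vecMul, dotProduct]
    exact integrable_finsetSum _ fun p _ => (hABC p).mul (hFP p q)
  have hint2 : ∀ q, Integrable (fun x => vecMul (Cf x) (P x) q) mu := by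
    intro q
    simp only [vecMul, dotProduct]
    exact integrable_finsetSum _ fun p _ => (hCBC p).mul (hmin p q)
  have hhq : ∀ x q, h x q = vecMul (A x) (F x * P x) q - vecMul (Cf x) (P x) q := by
    intro x q; rw [hh]; rfl
  have hhint : ∀ q, Integrable (fun x => h x q) mu := by
    intro q; simp only [hhq]; exact (hint1 q).sub (hint2 q)
  have part1 : ∀ k ∈ U, ∀ q, r * ∫ x, h x q * ee (-k) x ∂mu = 0 := by
    intro k hk q
    have h1 := hnormal k hk
    rw [(hAR k).tsum_eq, (hCB k).tsum_eq] at h1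
    have h2 := congrFun h1 q
    simp only [hhq, sub_mul]
    rw [integral_sub, mul_sub, h2, sub_self]
    · simpa only [mul_comm] using (BC_ee (-k)).mul (hint1 q)
    · simpa only [mul_comm] using (BC_ee (-k)).mul (hint2 q)
  have hr0 : r ≠ 0 := by rw [hr]; simp [Real.pi_ne_zero]
  -- the integrals J1, J3
  have hJ1 := int_form hABC hABC hFPG
  have hJ3 := int_form hCBC hCBC hmin
  have ptw : ∀ g : ℝ → Fin T → ℂ, ∀ᵐ x ∂mu,
      (A x - g x) ⬝ᵥ F x *ᵥ star (A x - g x) + g x ⬝ᵥ G x *ᵥ star (g x) =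
      A x ⬝ᵥ (F x * P x * G x) *ᵥ star (A x) + Cf x ⬝ᵥ P x *ᵥ star (Cf x)
       - (g x - h x) ⬝ᵥ star (Cf x) - Cf x ⬝ᵥ star (g x - h x)
       + (g x - h x) ⬝ᵥ (F x + G x) *ᵥ star (g x - h x) := by
    intro g
    filter_upwards [hall] with x hx
    exact pt_id hx.1.1.eq hx.2.2.1.1.eq hx.2.2.2.1 hx.2.2.2.2 _ _ _ _ (hh x)
  have formA : ∀ (x : ℝ) (g : ℝ → Fin T → ℂ),
      ∑ p, ∑ q, (A x p - g x p) * F x p q * (starRingEnd ℂ) (A x q - g x q) =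
        (A x - g x) ⬝ᵥ F x *ᵥ star (A x - g x) := fun x g => form_eq (A x - g x) (A x - g x) (F x)
  simp only [formA, form_eq] at hΔ
  have nn : ∀ {N : Matrix (Fin T) (Fin T) ℂ}, N.PosSemidef → ∀ u : Fin T → ℂ,
      0 ≤ u ⬝ᵥ N *ᵥ star u := by
    intro N hN u
    have := hN.dotProduct_mulVec_nonneg (star u)
    rwa [star_star] at this
  have Dh : Δ h = r * ((∫ x, A x ⬝ᵥ (F x * P x * G x) *ᵥ star (A x) ∂mu) +
      ∫ x, Cf x ⬝ᵥ P x *ᵥ star (Cf x) ∂mu) := by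
    have hp : ∀ᵐ x ∂mu, (A x - h x) ⬝ᵥ F x *ᵥ star (A x - h x) + h x ⬝ᵥ G x *ᵥ star (h x) =
      A x ⬝ᵥ (F x * P x * G x) *ᵥ star (A x) + Cf x ⬝ᵥ P x *ᵥ star (Cf x) := by
      filter_upwards [ptw h] with x hx
      rw [hx]; simp
    have hsumI := (hJ1.add hJ3).congr (hp.mono fun x hx => hx.symm)
    have hhm : ∀ q, AEStronglyMeasurable (fun x => h x q) mu :=
      fun q => (hhint q).aestronglyMeasurable
    have formm : ∀ (v : ℝ → Fin T → ℂ) (N : ℝ → Matrix (Fin T) (Fin T) ℂ),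
        (∀ q, AEStronglyMeasurable (fun x => v x q) mu) →
        (∀ p q, AEStronglyMeasurable (fun x => N x p q) mu) →
        AEStronglyMeasurable (fun x => v x ⬝ᵥ N x *ᵥ star (v x)) mu := by
      intro v N hv hN
      simp only [← form_eq]
      refine Finset.aestronglyMeasurable_fun_sum _ fun p _ =>
        Finset.aestronglyMeasurable_fun_sum _ fun q _ => ?_
      exact ((hv p).mul (hN p q)).mul
        (Complex.continuous_conj.comp_aestronglyMeasurable (hv q))
    have hX2m : AEStronglyMeasurable (fun x => h x ⬝ᵥ G x *ᵥ star (h x)) mu :=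
      formm h G hhm (fun p q => (hGint p q).aestronglyMeasurable)
    have hX2 : Integrable (fun x => h x ⬝ᵥ G x *ᵥ star (h x)) mu := by
      refine hsumI.mono hX2m ?_
      filter_upwards [hall] with x hx
      have h1 := nn hx.1 (A x - h x)
      have h2 := nn hx.2.1 (h x)
      have h3 := Complex.norm_of_nonneg' h2
      have h4 := Complex.norm_of_nonneg' (add_nonneg h1 h2)
      have h5 : h x ⬝ᵥ G x *ᵥ star (h x) ≤
        (A x - h x) ⬝ᵥ F x *ᵥ star (A x - h x) + h x ⬝ᵥ G x *ᵥ star (h x) :=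
        le_add_of_nonneg_left h1
      exact Complex.real_le_real.1 (h3.le.trans (h5.trans h4.ge))
    have hX1 : Integrable (fun x => (A x - h x) ⬝ᵥ F x *ᵥ star (A x - h x)) mu := by
      refine (hsumI.sub hX2).congr (Filter.Eventually.of_forall fun x => ?_)
      simp
    rw [hΔ, ← mul_add, ← integral_add hX1 hX2, integral_congr_ae hp, integral_add hJ1 hJ3]
  refine ⟨part1, ?_, ?_⟩
  · intro b hbf hb
    set g : ℝ → Fin T → ℂ := fun x k => ∑' n : ℤ, b n k * ee n x with hg
    have hbs : ∀ p, Summable fun n => ‖b n p‖ := by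
      intro p
      refine summable_of_hasFiniteSupport (hbf.subset ?_)
      intro n hn hn0
      apply hn; simp [hn0]
    have hgBC : ∀ p, BC (fun x => g x p) := fun p => BC_series ee_cont ee_norm (hbs p)
    have horth : ∀ q, ∫ x, Cf x q * (starRingEnd ℂ) (g x q - h x q) ∂mu = 0 := by
      intro q
      simp only [hCf]
      refine int_mul_conj_zero (BC_vec hcSum q) ((hgBC q).int.sub (hhint q)) ?_
      intro j
      by_cases hj : j ∈ U
      · right
        simp only [Pi.sub_apply, sub_mul]
        rw [integral_sub]
        · have h1 : ∫ x, h x q * ee (-j) x ∂mu = 0 := by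
            simpa [hr0] using part1 j hj q
          have h2 : ∫ x, g x q * ee (-j) x ∂mu = 0 := by
            refine (series_int ee_cont ee_norm (hbs q) (BC_ee (-j)).int).unique ?_
            convert hasSum_zero using 2 with n
            by_cases hn : b n = 0
            · simp [hn]
            · have hne : n + -j ≠ 0 := by
                intro h0
                have : n = j := by omega
                subst this
                have h3 := hb n hn
                rw [hZneg] at h3
                rw [hU] at hj
                rcases hj with hj | hj
                · exact h3.2 hj
                · have h4 : n < 0 := h3.1
                  have h5 : 0 ≤ n := hj
                  omega
              simp only [← ee_add]
              rw [ee_orth _ hne, mul_zero]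
          rw [h1, h2, sub_zero]
        · simpa only [mul_comm] using (BC_ee (-j)).mul (hgBC q).int
        · simpa only [mul_comm] using (BC_ee (-j)).mul (hhint q)
      · left; simp [hc0 j hj]
    have hKi : ∀ q, Integrable (fun x => Cf x q * (starRingEnd ℂ) (g x q - h x q)) mu :=
      fun q => (hCBC q).mul (int_conj ((hgBC q).int.sub (hhint q)))
    have hK : Integrable (fun x => Cf x ⬝ᵥ star (g x - h x)) mu :=
      integrable_finsetSum _ fun q _ => hKi q
    have hK0 : ∫ x, Cf x ⬝ᵥ star (g x - h x) ∂mu = 0 := by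
      have : ∫ x, Cf x ⬝ᵥ star (g x - h x) ∂mu =
          ∑ q, ∫ x, Cf x q * (starRingEnd ℂ) (g x q - h x q) ∂mu :=
        integral_finsetSum _ fun q _ => hKi q
      rw [this]; exact Finset.sum_eq_zero fun q _ => horth q
    have hKre : ∀ x, ((g x - h x) ⬝ᵥ star (Cf x)).re = (Cf x ⬝ᵥ star (g x - h x)).re := by
      intro x
      rw [Matrix.dotProduct_star, dotProduct_comm]; simp
    have hX1 := int_form (u := fun x => A x - g x) (v := fun x => A x - g x) (N := F)
      (fun p => (hABC p).sub (hgBC p)) (fun p => (hABC p).sub (hgBC p)) hFint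
    have hX2 := int_form hgBC hgBC hGint
    rw [Dh, hΔ, ← mul_add, ← integral_add hX1 hX2, ← integral_add hJ1 hJ3, hrr,
      Complex.re_ofReal_mul, Complex.re_ofReal_mul]
    refine mul_le_mul_of_nonneg_left ?_ hrpos
    have hKr : ∫ x, (Cf x ⬝ᵥ star (g x - h x)).re ∂mu = 0 := by
      have := integral_re hK
      simp only [RCLike.re_to_complex] at this
      rw [this, hK0]; simp
    have e1 := integral_re (hJ1.add hJ3)
    have e2 := integral_re (hX1.add hX2)
    simp only [RCLike.re_to_complex, Pi.add_apply] at e1 e2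
    rw [← e1, ← e2]
    have e3 : ∫ x, (A x ⬝ᵥ (F x * P x * G x) *ᵥ star (A x) + Cf x ⬝ᵥ P x *ᵥ star (Cf x)).re ∂mu =
        ∫ x, ((A x ⬝ᵥ (F x * P x * G x) *ᵥ star (A x) + Cf x ⬝ᵥ P x *ᵥ star (Cf x)).re -
          2 * (Cf x ⬝ᵥ star (g x - h x)).re) ∂mu := by
      refine Eq.symm ((integral_sub (hJ1.add hJ3).re (hK.re.const_mul 2)).trans ?_)
      have : ∫ x, 2 * RCLike.re (Cf x ⬝ᵥ star (g x - h x)) ∂mu = 0 := by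
        rw [integral_const_mul]; exact mul_eq_zero_of_right _ hKr
      rw [this, sub_zero]; rfl
    rw [e3]
    refine integral_mono_ae ((hJ1.add hJ3).re.sub (hK.re.const_mul 2)) (hX1.add hX2).re ?_
    filter_upwards [ptw g, hall] with x hx hx2
    have h1 := (Complex.le_def.1 (nn (hx2.1.add hx2.2.1) (g x - h x))).1
    have h2 := congrArg Complex.re hx
    have h3 := hKre x
    simp only [Complex.add_re, Complex.sub_re, Complex.zero_re] at h1 h2 ⊢
    linarith
  · rw [Dh, mul_add, add_comm]
    congr 1
    · symm
      have h1 : ∀ q, HasSum (fun k => (starRingEnd ℂ) (c k q) *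
          ∫ x, ee (-k) x * vecMul (Cf x) (P x) q ∂mu)
          (∫ x, (starRingEnd ℂ) (Cf x q) * vecMul (Cf x) (P x) q ∂mu) := by
        intro q
        have h2 := series_int eeNc eeNn (u := fun k => (starRingEnd ℂ) (c k q))
          (by simpa using BC_vec hcSum q) (hint2 q)
        have h3 : ∀ x, (starRingEnd ℂ) (Cf x q) =
            ∑' k : ℤ, (starRingEnd ℂ) (c k q) * ee (-k) x := by
          intro x
          rw [hCf, Complex.conj_tsum]
          simp only [map_mul, ee_conj]
        simp only [h3]
        exact h2
      have h4 := (hasSum_sum (s := Finset.univ) fun q _ => h1 q).mul_left r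
      have h5 : ∑ q, ∫ x, (starRingEnd ℂ) (Cf x q) * vecMul (Cf x) (P x) q ∂mu =
          ∫ x, Cf x ⬝ᵥ P x *ᵥ star (Cf x) ∂mu := by
        rw [← integral_finsetSum _ (fun q _ => (hCBC q).conj.mul (hint2 q))]
        congr 1; funext x
        rw [dotProduct_mulVec, dotProduct_comm]
        rfl
      rw [h5] at h4
      rw [← h4.tsum_eq]
      congr 1; funext k
      by_cases hk : k ∈ U
      · rw [hnormal k hk, (hCB k).tsum_eq, Finset.mul_sum]
        refine Finset.sum_congr rfl fun q _ => ?_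
        simp only [mul_comm (ee (-k) _)]
        ring
      · simp [hc0 k hk]
    · symm
      have hprod : ∀ p q x, A x p * (starRingEnd ℂ) (A x q) =
          ∑' jk : ℤ × ℤ, (a jk.1 p * (starRingEnd ℂ) (a jk.2 q)) *
            (ee (-jk.1) x * ee jk.2 x) := by
        intro p q x
        have hs1 : Summable fun j => ‖a j p * ee (-j) x‖ := by
          simpa [ee_norm] using BC_vec haSum p
        have hs2 : Summable fun j => ‖(starRingEnd ℂ) (a j q) * ee j x‖ := by
          simpa [ee_norm] using BC_vec haSum q
        have h3 : (starRingEnd ℂ) (A x q) = ∑' k : ℤ, (starRingEnd ℂ) (a k q) * ee k x := by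
          rw [hA, Complex.conj_tsum]
          simp only [map_mul, ee_conj, neg_neg]
        rw [h3, hA, tsum_mul_tsum_of_summable_norm hs1 hs2]
        congr 1; funext jk; ring
      have h1 : ∀ p q, HasSum (fun jk : ℤ × ℤ => (a jk.1 p * (starRingEnd ℂ) (a jk.2 q)) *
          ∫ x, (ee (-jk.1) x * ee jk.2 x) * (F x * P x * G x) p q ∂mu)
          (∫ x, (A x p * (starRingEnd ℂ) (A x q)) * (F x * P x * G x) p q ∂mu) := by
        intro p q
        simp only [hprod]
        refine series_int (e := fun (jk : ℤ × ℤ) x => ee (-jk.1) x * ee jk.2 x)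
          (u := fun jk : ℤ × ℤ => a jk.1 p * (starRingEnd ℂ) (a jk.2 q))
          (fun jk => (ee_cont _).mul (ee_cont _)) (by simp [ee_norm]) ?_ (hFPG p q)
        have hs := (BC_vec haSum p).mul_of_nonneg (BC_vec haSum q)
          (fun _ => norm_nonneg _) (fun _ => norm_nonneg _)
        simpa only [norm_mul, RCLike.norm_conj] using hs
      have h4 := (hasSum_sum (s := Finset.univ) fun p _ =>
        hasSum_sum (s := Finset.univ) fun q _ => h1 p q).mul_left r
      have hi : ∀ p q, Integrable
          (fun x => (A x p * (starRingEnd ℂ) (A x q)) * (F x * P x * G x) p q) mu := by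
        intro p q
        simpa only [mul_assoc] using (hABC p).mul ((hABC q).conj.mul (hFPG p q))
      have h5 : ∑ p, ∑ q, ∫ x, (A x p * (starRingEnd ℂ) (A x q)) * (F x * P x * G x) p q ∂mu =
          ∫ x, A x ⬝ᵥ (F x * P x * G x) *ᵥ star (A x) ∂mu := by
        simp only [← form_eq]
        rw [integral_finsetSum _ (fun p _ => integrable_finsetSum _ fun q _ => by
          simpa only [mul_right_comm] using hi p q)]
        refine Finset.sum_congr rfl fun p _ => ?_
        rw [integral_finsetSum _ (fun q _ => by simpa only [mul_right_comm] using hi p q)]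
        refine Finset.sum_congr rfl fun q _ => ?_
        congr 1; funext x; ring
      rw [h5] at h4
      rw [← h4.tsum_eq]
      congr 1; funext jk
      rw [Finset.mul_sum]
      refine Finset.sum_congr rfl fun p _ => ?_
      rw [Finset.mul_sum]
      refine Finset.sum_congr rfl fun q _ => ?_
      rw [hQ]
      simp only [mul_comm (ee (-jk.1) _ * ee jk.2 _)]
      ring
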